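/- Let i, j, r, s be positive integers with i > j and r > s. If A_i·A_s = A_r·A_j (equivalently, A_i/A_j = A_r/A_s), then i = r and j = s. -/

import Mathlib

/-- The sequence `A_i` for the wild Kronecker quiver `K_n`:
`A_0 = 0`, `A_1 = 1`, `A_{i+2} = n·A_{i+1} − A_i`. -/
def kroneckerA (n : ℤ) : ℕ → ℤ
  | 0 => 0
  | 1 => 1
  | (i + 2) => n * kroneckerA n (i + 1) - kroneckerA n i

theorem kroneckerA_add_two (n : ℤ) (k : ℕ) :
    kroneckerA n (k + 2) = n * kroneckerA n (k + 1) - kroneckerA n k := by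
  rw [kroneckerA]

theorem kroneckerA_cassini (n : ℤ) (k : ℕ) :
    kroneckerA n (k + 2) * kroneckerA n k + 1 = kroneckerA n (k + 1) ^ 2 := by
  induction k with
  | zero => simp [kroneckerA]
  | succ k ih =>
    have h₁ := kroneckerA_add_two n k
    have h₂ := kroneckerA_add_two n (k + 1)
    rw [show k + 1 + 2 = k + 3 from rfl, show k + 1 + 1 = k + 2 from rfl] at *
    linear_combination ih + kroneckerA n (k + 1) * h₂ - kroneckerA n (k + 2) * h₁

theorem kroneckerA_docagne (n : ℤ) (k e : ℕ) :
    kroneckerA n (k + e + 1) * kroneckerA n k + kroneckerA n e =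
      kroneckerA n (k + e) * kroneckerA n (k + 1) := by
  induction e using Nat.twoStepInduction with
  | zero => simp [kroneckerA, mul_comm]
  | one => simpa [kroneckerA, sq] using kroneckerA_cassini n k
  | more e ih₁ ih₂ =>
    have h₁ := kroneckerA_add_two n e
    have h₂ := kroneckerA_add_two n (k + e)
    have h₃ := kroneckerA_add_two n (k + e + 1)
    simp only [← add_assoc] at *
    linear_combination n * ih₂ - ih₁ + h₁ + kroneckerA n k * h₃ - kroneckerA n (k + 1) * h₂

theorem kroneckerA_vajda (n : ℤ) (k e d : ℕ) :
    kroneckerA n (k + e + d) * kroneckerA n k + kroneckerA n d * kroneckerA n e =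
      kroneckerA n (k + e) * kroneckerA n (k + d) := by
  induction d using Nat.twoStepInduction with
  | zero => simp [kroneckerA]
  | one => simpa [kroneckerA] using kroneckerA_docagne n k e
  | more d ih₁ ih₂ =>
    have h₁ := kroneckerA_add_two n d
    have h₂ := kroneckerA_add_two n (k + d)
    have h₃ := kroneckerA_add_two n (k + e + d)
    simp only [← add_assoc] at *
    linear_combination n * ih₂ - ih₁ + kroneckerA n e * h₁ + kroneckerA n k * h₃ -
      kroneckerA n (k + e) * h₂

theorem kroneckerA_add_add_one (n : ℤ) (a b : ℕ) :
    kroneckerA n (a + b + 1) =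
      kroneckerA n (a + 1) * kroneckerA n (b + 1) - kroneckerA n a * kroneckerA n b := by
  have h := kroneckerA_vajda n 1 a b
  rw [show 1 + a + b = a + b + 1 by ring, add_comm 1 a, add_comm 1 b] at h
  simp only [kroneckerA] at h
  linear_combination h

section

variable {n : ℤ}

theorem kroneckerA_growth (hn : 3 ≤ n) (k : ℕ) :
    0 ≤ kroneckerA n k ∧ 2 * kroneckerA n k + 1 ≤ kroneckerA n (k + 1) := by
  induction k with
  | zero => simp [kroneckerA]
  | succ k ih =>
    obtain ⟨h₀, h₁⟩ := ih
    refine ⟨by linarith, ?_⟩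
    rw [kroneckerA_add_two]
    nlinarith

theorem kroneckerA_nonneg (hn : 3 ≤ n) (k : ℕ) : 0 ≤ kroneckerA n k :=
  (kroneckerA_growth hn k).1

theorem kroneckerA_strictMono (hn : 3 ≤ n) : StrictMono (kroneckerA n) :=
  strictMono_nat_of_lt_succ fun k => by
    have := kroneckerA_growth hn k
    linarith

theorem kroneckerA_pos (hn : 3 ≤ n) {k : ℕ} (hk : 0 < k) : 0 < kroneckerA n k := by
  simpa [kroneckerA] using kroneckerA_strictMono hn hk

theorem kroneckerA_mul_lt (hn : 3 ≤ n) (a : ℕ) {b : ℕ} (hb : 0 < b) :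
    kroneckerA n a * kroneckerA n b < kroneckerA n (a + b) := by
  obtain ⟨b, rfl⟩ := Nat.exists_eq_add_of_lt hb
  simp only [zero_add, ← add_assoc]
  rw [kroneckerA_add_add_one]
  obtain ⟨ha, ha'⟩ := kroneckerA_growth hn a
  obtain ⟨hb, hb'⟩ := kroneckerA_growth hn b
  nlinarith [mul_nonneg ha hb]

theorem kroneckerA_le_mul (hn : 3 ≤ n) (a b : ℕ) :
    kroneckerA n (a + b + 1) ≤ kroneckerA n (a + 1) * kroneckerA n (b + 1) := by
  rw [kroneckerA_add_add_one]
  linarith [mul_nonneg (kroneckerA_nonneg hn a) (kroneckerA_nonneg hn b)]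

theorem kroneckerA_mul_lt_mul_of_add_lt_add (hn : 3 ≤ n) {a b c d : ℕ} (ha : 0 < a) (hb : 0 < b)
    (hd : 0 < d) (h : c + d < a + b) :
    kroneckerA n c * kroneckerA n d < kroneckerA n a * kroneckerA n b := by
  obtain ⟨a, rfl⟩ := Nat.exists_eq_add_of_lt ha
  obtain ⟨b, rfl⟩ := Nat.exists_eq_add_of_lt hb
  simp only [zero_add] at *
  calc kroneckerA n c * kroneckerA n d < kroneckerA n (c + d) := kroneckerA_mul_lt hn c hd
    _ ≤ kroneckerA n (a + b + 1) := (kroneckerA_strictMono hn).monotone (by omega)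
    _ ≤ _ := kroneckerA_le_mul hn a b

theorem kroneckerA_mul_lt_mul_of_add_eq_add (hn : 3 ≤ n) {i j r s : ℕ} (hri : r < i)
    (hsr : s < r) (h : i + s = r + j) :
    kroneckerA n i * kroneckerA n s < kroneckerA n r * kroneckerA n j := by
  obtain ⟨e, rfl⟩ := Nat.exists_eq_add_of_lt hsr
  obtain ⟨d, rfl⟩ := Nat.exists_eq_add_of_lt hri
  obtain rfl : j = s + (d + 1) := by omega
  have key := kroneckerA_vajda n s (e + 1) (d + 1)
  have hpos := mul_pos (kroneckerA_pos hn d.succ_pos) (kroneckerA_pos hn e.succ_pos)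
  simp only [← add_assoc, Nat.succ_eq_add_one] at *
  linarith

end

theorem stmt_13 (n : ℤ) (hn : 3 ≤ n) (i j r s : ℕ)
    (hj : 1 ≤ j) (hs : 1 ≤ s) (hij : j < i) (hrs : s < r)
    (h : kroneckerA n i * kroneckerA n s = kroneckerA n r * kroneckerA n j) :
    i = r ∧ j = s := by
  rcases lt_trichotomy (i + s) (r + j) with hlt | heq | hgt
  · exact absurd h
      (kroneckerA_mul_lt_mul_of_add_lt_add hn (by omega) (by omega) (by omega) hlt).ne
  · rcases lt_trichotomy i r with hir | hir | hir
    · exact absurd h (kroneckerA_mul_lt_mul_of_add_eq_add hn hir hij heq.symm).ne'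
    · omega
    · exact absurd h (kroneckerA_mul_lt_mul_of_add_eq_add hn hir hrs heq).ne
  · exact absurd h
      (kroneckerA_mul_lt_mul_of_add_lt_add hn (by omega) (by omega) (by omega) hgt).ne'
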